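/- Let m ≥ 2 and define μ₂ = m² if m is odd and μ₂ = m²/2 if m is even. Let n ∈ ℕ₀ and write n in base m as n = a_0 + a_1·m + ⋯ + a_s·m^s with digits 0 ≤ a_j ≤ m−1. Then b_m(mn) ≡ ∏_{i=0}^s (a_i + 1) + m·∑_{i=1}^s [ (a_i(a_i+1)/2) · ∏_{0 ≤ j ≤ s, j ≠ i, j ≠ i−1} (a_j + 1) ] (mod μ₂). -/

import Mathlib

/-- The number of `m`-ary partitions of `n`. -/
noncomputable def mAryPartitions (m n : ℕ) : ℕ :=
  Nat.card {f : ℕ →₀ ℕ // (f.sum fun i c => c * m ^ i) = n}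

/-- Weight of a finitely supported function. -/
noncomputable def wt (m : ℕ) (f : ℕ →₀ ℕ) : ℕ := f.sum fun i c => c * m ^ i

/-- Split off the value at zero. -/
noncomputable def splitEquiv : (ℕ →₀ ℕ) ≃ ℕ × (ℕ →₀ ℕ) where
  toFun f := (f 0, f.comapDomain Nat.succ Nat.succ_injective.injOn)
  invFun p := Finsupp.single 0 p.1 + p.2.mapDomain Nat.succ
  left_inv f := by
    ext i
    cases i with
    | zero =>
      simp [Finsupp.mapDomain_of_notMem_range]
    | succ i =>
      have := Finsupp.mapDomain_apply Nat.succ_injective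
        (f.comapDomain Nat.succ Nat.succ_injective.injOn) i
      simp only [Nat.succ_eq_add_one] at this
      simp [this]
  right_inv p := by
    obtain ⟨c, g⟩ := p
    ext i
    · simp [Finsupp.mapDomain_of_notMem_range]
    · have := Finsupp.mapDomain_apply Nat.succ_injective g i
      simp only [Nat.succ_eq_add_one] at this
      simp [this]

lemma wt_split (m : ℕ) (p : ℕ × (ℕ →₀ ℕ)) : wt m (splitEquiv.symm p) = p.1 + m * wt m p.2 := by
  obtain ⟨c, g⟩ := p
  change wt m (Finsupp.single 0 c + g.mapDomain Nat.succ) = c + m * wt m g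
  unfold wt
  rw [Finsupp.sum_add_index' (by simp) (by intros; ring), Finsupp.sum_single_index (by simp),
    Finsupp.sum_mapDomain_index (by simp) (by intros; ring), Finsupp.mul_sum]
  simp only [pow_zero, mul_one, Nat.succ_eq_add_one]
  congr 1
  apply Finsupp.sum_congr
  intros
  ring

/-- Main recursive bijection. -/
noncomputable def recEquiv (m : ℕ) (hm : 2 ≤ m) (N : ℕ) :
    {f : ℕ →₀ ℕ // wt m f = N} ≃ Σ k : Fin (N / m + 1), {g : ℕ →₀ ℕ // wt m g = (k : ℕ)} :=
  (Equiv.subtypeEquiv (p := fun f => wt m f = N) (q := fun p => p.1 + m * wt m p.2 = N)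
    splitEquiv (by
      intro f
      rw [← wt_split, Equiv.symm_apply_apply])).trans
  { toFun := fun p => ⟨⟨wt m p.1.2, by
      have := p.2
      rw [Nat.lt_succ_iff, Nat.le_div_iff_mul_le (by omega), mul_comm]
      omega⟩, p.1.2, rfl⟩
    invFun := fun x => ⟨(N - m * x.1, x.2.1), by
      have h1 := x.2.2
      have h2 := x.1.2
      rw [Nat.lt_succ_iff, Nat.le_div_iff_mul_le (by omega), mul_comm] at h2
      dsimp only
      rw [h1]
      omega⟩
    left_inv := by
      rintro ⟨⟨c, g⟩, h⟩
      dsimp only at h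
      apply Subtype.ext
      refine Prod.ext ?_ rfl
      dsimp only
      omega
    right_inv := by
      rintro ⟨⟨k, hk⟩, g, h⟩
      dsimp only at h
      subst h
      rfl }

lemma fin_wt (m : ℕ) (hm : 2 ≤ m) (N : ℕ) : Finite {f : ℕ →₀ ℕ // wt m f = N} := by
  induction N using Nat.strong_induction_on with
  | _ N ih =>
    rcases Nat.eq_zero_or_pos N with h | h
    · subst h
      have : Subsingleton {f : ℕ →₀ ℕ // wt m f = 0} := by
        have key : ∀ f : ℕ →₀ ℕ, wt m f = 0 → f = 0 := by
          intro f hf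
          ext i
          by_contra hi
          unfold wt Finsupp.sum at hf
          rw [Finset.sum_eq_zero_iff] at hf
          have := hf i (by simpa using hi)
          have h2 : 0 < m ^ i := by positivity
          rcases Nat.mul_eq_zero.mp this with h | h
          · exact hi (by simpa using h)
          · omega
        exact ⟨fun f g => Subtype.ext ((key _ f.2).trans (key _ g.2).symm)⟩
      infer_instance
    · have : ∀ k : Fin (N / m + 1), Finite {g : ℕ →₀ ℕ // wt m g = (k : ℕ)} := by
        intro k
        apply ih
        have := k.2
        have := Nat.div_lt_self h (show 1 < m by omega)
        omega
      exact Finite.of_equiv _ (recEquiv m hm N).symm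

lemma b_rec (m : ℕ) (hm : 2 ≤ m) (N : ℕ) :
    mAryPartitions m N = ∑ k ∈ Finset.range (N / m + 1), mAryPartitions m k := by
  have : ∀ k : Fin (N / m + 1), Finite {g : ℕ →₀ ℕ // wt m g = (k : ℕ)} :=
    fun k => fin_wt m hm k
  have h := Nat.card_congr (recEquiv m hm N)
  rw [Nat.card_sigma] at h
  rw [Finset.sum_range]
  exact h

lemma b_zero (m : ℕ) (hm : 2 ≤ m) : mAryPartitions m 0 = 1 := by
  unfold mAryPartitions
  rw [Nat.card_eq_one_iff_unique]
  refine ⟨⟨?_⟩, ⟨⟨0, by simp⟩⟩⟩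
  have key : ∀ f : ℕ →₀ ℕ, wt m f = 0 → f = 0 := by
    intro f hf
    ext i
    by_contra hi
    unfold wt Finsupp.sum at hf
    rw [Finset.sum_eq_zero_iff] at hf
    have := hf i (by simpa using hi)
    have h2 : 0 < m ^ i := by positivity
    rcases Nat.mul_eq_zero.mp this with h | h
    · exact hi (by simpa using h)
    · omega
  exact fun f g => Subtype.ext ((key _ f.2).trans (key _ g.2).symm)

/-- `c n = b (m n)`. -/
noncomputable def cc (m n : ℕ) : ℕ := mAryPartitions m (m * n)

lemma b_eq_cc (m : ℕ) (hm : 2 ≤ m) (k : ℕ) : mAryPartitions m k = cc m (k / m) := by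
  unfold cc
  rw [b_rec m hm k, b_rec m hm (m * (k / m)), Nat.mul_div_cancel_left _ (by omega)]

lemma sum_blocks (m : ℕ) (h : ℕ → ℕ) (q a : ℕ) :
    ∑ k ∈ Finset.range (m * q + a), h k =
      ∑ t ∈ Finset.range q, ∑ j ∈ Finset.range m, h (m * t + j) +
        ∑ j ∈ Finset.range a, h (m * q + j) := by
  rw [Finset.sum_range_add]
  congr 1
  induction q with
  | zero => simp
  | succ q ih => rw [mul_add, mul_one, Finset.sum_range_add, ih, Finset.sum_range_succ]

lemma cc_rec (m : ℕ) (hm : 2 ≤ m) (q a : ℕ) (ha : a < m) :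
    cc m (m * q + a) = (a + 1) * cc m q + m * ∑ t ∈ Finset.range q, cc m t := by
  have h1 : cc m (m * q + a) = ∑ k ∈ Finset.range (m * q + (a + 1)), cc m (k / m) := by
    conv_lhs => unfold cc
    rw [b_rec m hm, Nat.mul_div_cancel_left _ (by omega)]
    exact Finset.sum_congr rfl fun k _ => b_eq_cc m hm k
  rw [h1, sum_blocks]
  have h2 : ∀ t j, j < m → (m * t + j) / m = t := by
    intro t j hj
    rw [Nat.mul_add_div (by omega), Nat.div_eq_of_lt hj, add_zero]
  have h3 : ∀ t, ∑ j ∈ Finset.range m, cc m ((m * t + j) / m) = m * cc m t := by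
    intro t
    rw [Finset.sum_congr rfl (g := fun _ => cc m t)
      (fun j hj => by rw [h2 t j (Finset.mem_range.mp hj)])]
    simp
  have h4 : ∑ j ∈ Finset.range (a + 1), cc m ((m * q + j) / m) = (a + 1) * cc m q := by
    rw [Finset.sum_congr rfl (g := fun _ => cc m q)
      (fun j hj => by rw [h2 q j (by have := Finset.mem_range.mp hj; omega)])]
    simp
  rw [h4, Finset.sum_congr rfl (fun t _ => h3 t), ← Finset.mul_sum, add_comm]

lemma cc_mod (m : ℕ) (hm : 2 ≤ m) (q a : ℕ) (ha : a < m) :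
    cc m (m * q + a) ≡ (a + 1) * cc m q [MOD m] := by
  rw [cc_rec m hm q a ha]
  simp [Nat.ModEq]

/-- The reduced modulus. -/
def mu1 (m : ℕ) : ℕ := if m % 2 = 0 then m / 2 else m

lemma mu1_dvd (m : ℕ) : mu1 m ∣ m := by
  unfold mu1
  split_ifs with h
  · exact Nat.div_dvd_of_dvd (Nat.dvd_of_mod_eq_zero h)
  · exact dvd_rfl

lemma mu2_eq (m : ℕ) : (if m % 2 = 0 then m ^ 2 / 2 else m ^ 2) = m * mu1 m := by
  unfold mu1
  split_ifs with h
  · rw [sq, Nat.mul_div_assoc _ (Nat.dvd_of_mod_eq_zero h)]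
  · ring

lemma tri (a : ℕ) : ∑ j ∈ Finset.range a, (j + 1) = a * (a + 1) / 2 := by
  have := Finset.sum_range_id (a + 1)
  rw [Finset.sum_range_succ'] at this
  simpa [mul_comm] using this

lemma mu1_dvd_tri (m : ℕ) : mu1 m ∣ ∑ j ∈ Finset.range m, (j + 1) := by
  rw [tri]
  unfold mu1
  split_ifs with h
  · obtain ⟨k, rfl⟩ := Nat.dvd_of_mod_eq_zero h
    rw [mul_assoc, Nat.mul_div_cancel_left _ (by norm_num), Nat.mul_div_cancel_left _ (by norm_num)]
    exact dvd_mul_right _ _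
  · rw [Nat.mul_div_assoc _ (by omega)]
    exact dvd_mul_right _ _

lemma modEq_of_eq' {M x y : ℕ} (h : x = y) : x ≡ y [MOD M] := by rw [h]

lemma modEq_sum {M : ℕ} (s : Finset ℕ) (f g : ℕ → ℕ) (h : ∀ i ∈ s, f i ≡ g i [MOD M]) :
    ∑ i ∈ s, f i ≡ ∑ i ∈ s, g i [MOD M] := by
  induction s using Finset.induction_on with
  | empty => rfl
  | insert x s hx ih =>
    rw [Finset.sum_insert hx, Finset.sum_insert hx]
    exact (h x (by simp)).add (ih fun i hi => h i (by simp [hi]))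

lemma S_mod (m : ℕ) (hm : 2 ≤ m) (r a : ℕ) (ha : a < m) :
    ∑ t ∈ Finset.range (m * r + a), cc m t ≡ a * (a + 1) / 2 * cc m r [MOD mu1 m] := by
  rw [sum_blocks]
  have h1 : ∀ t b, b ≤ m → ∑ j ∈ Finset.range b, cc m (m * t + j) ≡
      (∑ j ∈ Finset.range b, (j + 1)) * cc m t [MOD mu1 m] := by
    intro t b hb
    rw [Finset.sum_mul]
    apply modEq_sum
    intro j hj
    exact (cc_mod m hm t j (by have := Finset.mem_range.mp hj; omega)).of_dvd (mu1_dvd m)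
  have h2 : ∑ t ∈ Finset.range r, ∑ j ∈ Finset.range m, cc m (m * t + j) ≡ 0 [MOD mu1 m] := by
    have : ∑ t ∈ Finset.range r, ∑ j ∈ Finset.range m, cc m (m * t + j) ≡
        ∑ t ∈ Finset.range r, 0 [MOD mu1 m] := by
      apply modEq_sum
      intro t _
      refine (h1 t m le_rfl).trans ?_
      rw [Nat.modEq_zero_iff_dvd]
      exact (mu1_dvd_tri m).mul_right _
    simpa using this
  have h3 := h2.add (h1 r a ha.le)
  rwa [tri, zero_add] at h3

lemma cc_mod2 (m : ℕ) (hm : 2 ≤ m) (r a₀ a₁ : ℕ) (h₀ : a₀ < m) (h₁ : a₁ < m) :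
    cc m (m * (m * r + a₁) + a₀) ≡
      (a₀ + 1) * cc m (m * r + a₁) + m * (a₁ * (a₁ + 1) / 2 * cc m r) [MOD m * mu1 m] := by
  rw [cc_rec m hm _ a₀ h₀]
  exact Nat.ModEq.rfl.add ((S_mod m hm r a₁ h₁).mul_left' m)

/-- Number with given digits. -/
def num (m s : ℕ) (a : ℕ → ℕ) : ℕ := ∑ j ∈ Finset.range s, a j * m ^ j

lemma num_succ (m s : ℕ) (a : ℕ → ℕ) :
    num m (s + 1) a = m * num m s (fun j => a (j + 1)) + a 0 := by
  unfold num
  rw [Finset.sum_range_succ', Finset.mul_sum]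
  simp only [pow_zero, mul_one]
  congr 1
  exact Finset.sum_congr rfl fun j _ => by ring

lemma cc_zero (m : ℕ) (hm : 2 ≤ m) : cc m 0 = 1 := by
  unfold cc
  rw [mul_zero, b_zero m hm]

lemma cc_num_mod (m : ℕ) (hm : 2 ≤ m) (s : ℕ) : ∀ a : ℕ → ℕ, (∀ j < s, a j < m) →
    cc m (num m s a) ≡ ∏ i ∈ Finset.range s, (a i + 1) [MOD m] := by
  induction s with
  | zero => intro a _; simp [num, cc_zero m hm, Nat.ModEq]
  | succ s ih =>
    intro a ha
    rw [num_succ, Finset.prod_range_succ', mul_comm (∏ i ∈ _, _)]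
    refine (cc_mod m hm _ _ (ha 0 (by omega))).trans ?_
    exact (ih (fun j => a (j + 1)) (fun j hj => ha _ (by omega))).mul_left _

lemma main_aux (m : ℕ) (hm : 2 ≤ m) (s : ℕ) : ∀ a : ℕ → ℕ, (∀ j < s + 1, a j < m) →
    cc m (num m (s + 1) a) ≡ (∏ i ∈ Finset.range (s + 1), (a i + 1)) +
      m * ∑ k ∈ Finset.range s, (a (k + 1) * (a (k + 1) + 1) / 2) *
        ∏ j ∈ Finset.range (s + 1), (if j ≠ k + 1 ∧ j ≠ k then a j + 1 else 1)
      [MOD m * mu1 m] := by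
  induction s with
  | zero =>
    intro a ha
    rw [num_succ, cc_rec m hm _ _ (ha 0 (by omega))]
    simp [num, cc_zero m hm, Nat.ModEq]
  | succ s ih =>
    intro a ha
    have e := cc_mod2 m hm (num m s fun j => a (j + 2)) (a 0) (a 1) (ha 0 (by omega))
      (ha 1 (by omega))
    have e1 : m * num m s (fun j => a (j + 2)) + a 1 = num m (s + 1) (fun j => a (j + 1)) := by
      rw [num_succ]
    rw [e1, ← num_succ] at e
    refine e.trans ?_
    have i1 := (ih (fun j => a (j + 1)) (fun j hj => ha _ (by omega))).mul_left (a 0 + 1)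
    have i2 := (((cc_num_mod m hm s (fun j => a (j + 2)) (fun j hj => ha _ (by omega))).mul_left
      (a 1 * (a 1 + 1) / 2)).mul_left' m).of_dvd (mul_dvd_mul_left m (mu1_dvd m))
    refine (i1.add i2).trans ?_
    refine modEq_of_eq' ?_
    rw [Finset.prod_range_succ' _ (s + 1), Finset.sum_range_succ']
    have p0 : ∏ j ∈ Finset.range (s + 1 + 1), (if j ≠ 0 + 1 ∧ j ≠ 0 then a j + 1 else 1) =
        ∏ j ∈ Finset.range s, (a (j + 2) + 1) := by
      rw [Finset.prod_range_succ', Finset.prod_range_succ']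
      simp
    have p1 : ∀ k, ∏ j ∈ Finset.range (s + 1 + 1),
        (if j ≠ k + 1 + 1 ∧ j ≠ k + 1 then a j + 1 else 1) =
        (a 0 + 1) * ∏ j ∈ Finset.range (s + 1),
          (if j ≠ k + 1 ∧ j ≠ k then a (j + 1) + 1 else 1) := by
      intro k
      rw [Finset.prod_range_succ', mul_comm]
      simp
    rw [p0]
    simp only [p1]
    simp only [zero_add, mul_left_comm _ (a 0 + 1), ← Finset.mul_sum]
    ring

/-- Theorem 11 (TwCharpowersbm) of the paper. -/
theorem stmt_18 (m : ℕ) (hm : 2 ≤ m) (n s : ℕ) (a : ℕ → ℕ)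
    (ha : ∀ j : ℕ, j ≤ s → a j ≤ m - 1)
    (hn : n = ∑ j ∈ Finset.range (s + 1), a j * m ^ j) :
    mAryPartitions m (m * n) ≡
      (∏ i ∈ Finset.range (s + 1), (a i + 1)) +
        m * ∑ i ∈ Finset.Icc 1 s,
          (a i * (a i + 1) / 2) *
            ∏ j ∈ (Finset.range (s + 1)).filter (fun j => j ≠ i ∧ j ≠ i - 1), (a j + 1)
      [MOD (if m % 2 = 0 then m ^ 2 / 2 else m ^ 2)] := by
  have h := main_aux m hm s a (fun j hj => by have := ha j (by omega); omega)
  rw [mu2_eq, hn]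
  refine h.trans (modEq_of_eq' ?_)
  have e : Finset.Icc 1 s = Finset.Ico 1 (s + 1) := by
    ext; simp
  rw [e, Finset.sum_Ico_eq_sum_range]
  simp only [Finset.prod_filter, Nat.add_sub_cancel, add_comm 1]
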